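/- Let g be even, Γ̄ the tropical hyperelliptic curve of genus g, Γ its bounded part, and D* = (g/2)(V_0 + V_0′). For any 𝑷 = (P_1, …, P_g) ∈ Γ_g^+, the conjugate tuple 𝑷′ = (P_1′, …, P_g′) also lies in Γ_g^+ and 𝑷 + 𝑷′ = 𝒪 in the group (Γ_g^+, 𝒪); equivalently, φ̄(P_1 + ⋯ + P_g) + φ̄(P_1′ + ⋯ + P_g′) = 0 in J(Γ), so −𝑷 = 𝑷′. -/

import Mathlib

open scoped BigOperators

namespace TropicalHyperelliptic

/-! ## The tropical hyperelliptic curve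

For a genus `g ≥ 1` and parameters `c₋₁, c₀, …, c_{g+1}` (encoded as a function
`c : ℤ → ℝ`; only the values `c (-1), …, c (g+1)` matter), the tropical
polynomial `F̃(X,Y) = max(2Y, Y + P̃(X), c₋₁)` with
`P̃(X) = max_{0 ≤ i ≤ g+1} (c_i + iX)` defines the tropical hyperelliptic curve
`Γ̄` as the locus of points of `ℝ²` where `F̃` fails to be differentiable. -/

/-- The tropical polynomial `P̃(X) = max_{0 ≤ i ≤ g+1} (c_i + i X)`. -/
noncomputable def Ptilde (g : ℕ) (c : ℤ → ℝ) (X : ℝ) : ℝ :=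
  (Finset.range (g + 2)).sup' (Finset.nonempty_range_iff.mpr (by omega))
    fun i => c (i : ℤ) + (i : ℝ) * X

/-- The tropical polynomial `F̃(X,Y) = max(2Y, Y + P̃(X), c₋₁)`. -/
noncomputable def Ftilde (g : ℕ) (c : ℤ → ℝ) (P : ℝ × ℝ) : ℝ :=
  max (2 * P.2) (max (P.2 + Ptilde g c P.1) (c (-1)))

/-- The tropical hyperelliptic curve `Γ̄` of genus `g`: the set of points of
`ℝ²` at which `F̃` is not differentiable. -/
def curveBar (g : ℕ) (c : ℤ → ℝ) : Set (ℝ × ℝ) :=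
  {P | ¬ DifferentiableAt ℝ (Ftilde g c) P}

/-- The hypotheses on the parameters: `c_{g+1} = c_g = 0`, `c₋₁ < 2c₀`,
`cᵢ + c_{i+2} < 2c_{i+1}` for `0 ≤ i ≤ g − 2`, and `c_{g−1} < 2c_g = 0`.
Under these assumptions `Γ̄` is a smooth tropical curve of genus `g`. -/
def Hyp (g : ℕ) (c : ℤ → ℝ) : Prop :=
  c ((g : ℤ) + 1) = 0 ∧ c (g : ℤ) = 0 ∧ c (-1) < 2 * c 0 ∧
  (∀ i : ℕ, (i : ℤ) ≤ (g : ℤ) - 2 → c i + c ((i : ℤ) + 2) < 2 * c ((i : ℤ) + 1)) ∧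
  c ((g : ℤ) - 1) < 0

/-- The vertices `V_i` (`0 ≤ i ≤ g`) of `Γ̄` lying above the line
`Y = c₋₁/2`:  `V_0 = (0,0)` and
`V_i = (c_{g−i} − c_{g−i+1}, (g−i+1)c_{g−i} − (g−i)c_{g−i+1})`.
(The formula below also gives `V_0 = (0,0)` for `i = 0`, since
`c_g = c_{g+1} = 0`.) -/
noncomputable def V (g : ℕ) (c : ℤ → ℝ) (i : ℕ) : ℝ × ℝ :=
  (c ((g : ℤ) - i) - c ((g : ℤ) - i + 1),
   (((g : ℤ) - i + 1 : ℤ) : ℝ) * c ((g : ℤ) - i)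
     - (((g : ℤ) - i : ℤ) : ℝ) * c ((g : ℤ) - i + 1))

/-- The conjugate `P′` of a point `P`: the reflection with respect to the line
`Y = c₋₁/2`. -/
def conj (c : ℤ → ℝ) (P : ℝ × ℝ) : ℝ × ℝ := (P.1, c (-1) - P.2)

/-- The metric graph `Γ` obtained from `Γ̄` by removing all unbounded edges:
the part of `Γ̄` lying in the vertical strip `x(V_g) ≤ X ≤ x(V_0) = 0`,
where `x(V_g) = c_0 − c_1`. -/
def Gam (g : ℕ) (c : ℤ → ℝ) : Set (ℝ × ℝ) :=
  {P ∈ curveBar g c | c 0 - c 1 ≤ P.1 ∧ P.1 ≤ 0}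

/-! ## Rational functions, orders, and divisors -/

/-- The image in `ℝ²` of an integer vector. -/
def vr (v : ℤ × ℤ) : ℝ × ℝ := ((v.1 : ℝ), (v.2 : ℝ))

/-- The primitive integer directions along which one can leave the point `P`
inside the set `S` (the outgoing directions of the segments of `S` emanating
from `P`). -/
def localDirs (S : Set (ℝ × ℝ)) (P : ℝ × ℝ) : Set (ℤ × ℤ) :=
  {v | IsCoprime v.1 v.2 ∧ ∃ ε > (0 : ℝ), ∀ t : ℝ, 0 < t → t < ε → P + t • vr v ∈ S}

/-- `f` has (integer) outgoing slope `s` at `P` in the direction `v` (slopes are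
measured with respect to the lattice length). -/
def HasSlope (S : Set (ℝ × ℝ)) (f : ℝ × ℝ → ℝ) (P : ℝ × ℝ) (v : ℤ × ℤ) (s : ℤ) : Prop :=
  ∃ ε > (0 : ℝ), ∀ t : ℝ, 0 ≤ t → t < ε → P + t • vr v ∈ S →
    f (P + t • vr v) = f P + (s : ℝ) * t

/-- A rational function on (the tropical curve) `S ⊆ ℝ²`: a continuous function
whose restriction to every edge is piecewise linear with integer slopes,
i.e. which has an integer outgoing slope at every point of `S` in every
outgoing direction. -/
structure IsRationalFn (S : Set (ℝ × ℝ)) (f : ℝ × ℝ → ℝ) : Prop where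
  cont : ContinuousOn f S
  slope_int : ∀ P ∈ S, ∀ v ∈ localDirs S P, ∃ s : ℤ, HasSlope S f P v s

/-- The outgoing slope of `f` at `P` in the direction `v` (defaulting to `0`
when no integer slope exists). -/
noncomputable def slope (S : Set (ℝ × ℝ)) (f : ℝ × ℝ → ℝ) (P : ℝ × ℝ) (v : ℤ × ℤ) : ℤ :=
  open scoped Classical in
  if h : ∃ s : ℤ, HasSlope S f P v s then h.choose else 0

/-- The order `ord_P f`: the sum of the outgoing slopes of `f` over all segments
of `S` emanating from `P`.  Points with `ord_P f > 0` are the zeros of `f`,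
points with `ord_P f < 0` its poles. -/
noncomputable def ord (S : Set (ℝ × ℝ)) (f : ℝ × ℝ → ℝ) (P : ℝ × ℝ) : ℤ :=
  ∑ᶠ v ∈ localDirs S P, slope S f P v

/-- Divisors: formal `ℤ`-linear combinations of finitely many points of `ℝ²`. -/
abbrev Div := (ℝ × ℝ) →₀ ℤ

/-- The degree of a divisor: the sum of its coefficients. -/
def deg (D : Div) : ℤ := D.sum fun _ n => n

/-- A divisor is effective (`D > 0`) when all its coefficients are nonnegative. -/
def Eff (D : Div) : Prop := ∀ P, 0 ≤ D P

/-- `R(D)`: the set of rational functions `f` on `S` with `(f) + D` effective. -/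
def RSet (S : Set (ℝ × ℝ)) (D : Div) : Set ((ℝ × ℝ) → ℝ) :=
  {f | IsRationalFn S f ∧ ∀ P ∈ S, 0 ≤ ord S f P + D P}

/-- A divisor is principal when it is the divisor `(f) = Σ_P (ord_P f)·P` of a
rational function `f` on `S`. -/
def IsPrincipal (S : Set (ℝ × ℝ)) (D : Div) : Prop :=
  ∃ f : (ℝ × ℝ) → ℝ, IsRationalFn S f ∧ ∀ P, D P = ord S f P

/-- Two divisors are (linearly) equivalent, `D ∼ D′`, when `D′ = D + (f)` for
some rational function `f` on `S`. -/
def LinEquiv (S : Set (ℝ × ℝ)) (D D' : Div) : Prop :=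
  ∃ f : (ℝ × ℝ) → ℝ, IsRationalFn S f ∧ ∀ P, D' P = D P + ord S f P

end TropicalHyperelliptic

/-! ## The cycles `α_i` and the set `𝔇̃_g^+(Γ)` -/

namespace TropicalHyperelliptic

/-- The basis cycle `α_i` (`1 ≤ i ≤ g`) of the fundamental group `π₁(Γ)`:
the cycle of `Γ` through the vertices `V_{i−1}`, `V_i` and their conjugates
`V_{i−1}′`, `V_i′`, i.e. the part of `Γ` in the vertical strip
`x(V_i) ≤ X ≤ x(V_{i−1})`. -/
def alphaCycle (g : ℕ) (c : ℤ → ℝ) (i : ℕ) : Set (ℝ × ℝ) :=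
  {P ∈ Gam g c | (V g c i).1 ≤ P.1 ∧ P.1 ≤ (V g c (i - 1)).1}

/-- The overlap `α_{k,k+1} = (α_k ∩ α_{k+1}) ∖ {endpoints}` (`1 ≤ k ≤ g − 1`):
the open vertical edge of `Γ` joining `V_k` to `V_k′`.  (For non-adjacent
indices the overlaps `α_i ∩ α_j` are empty.) -/
def alphaOpen (g : ℕ) (c : ℤ → ℝ) (k : ℕ) : Set (ℝ × ℝ) :=
  {P ∈ Gam g c | P.1 = (V g c k).1 ∧ P ≠ V g c k ∧ P ≠ conj c (V g c k)}

/-- The subset `𝔇̃_g^+(Γ)` of `𝔇_g^+(Γ)`: effective divisors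
`P_1 + ⋯ + P_g` with `P_i ∈ α_i` for all `i`, such that each overlap `α_{ij}`
contains at most one of the points. -/
def Dtilde (g : ℕ) (c : ℤ → ℝ) : Set Div :=
  {D | ∃ Pt : Fin g → ℝ × ℝ,
    (∀ i : Fin g, Pt i ∈ alphaCycle g c (i + 1)) ∧
    (∀ k : ℕ, 1 ≤ k → k ≤ g - 1 →
      ∀ i j : Fin g, Pt i ∈ alphaOpen g c k → Pt j ∈ alphaOpen g c k → i = j) ∧
    D = ∑ i : Fin g, Finsupp.single (Pt i) (1 : ℤ)}

/-- For even `g`, the base divisor `D* = (g/2)(V_0 + V_0′)`. -/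
noncomputable def DstarEven (g : ℕ) (c : ℤ → ℝ) : Div :=
  ((g / 2 : ℕ) : ℤ) •
    (Finsupp.single (V g c 0) (1 : ℤ) + Finsupp.single (conj c (V g c 0)) (1 : ℤ))

/-- For odd `g`, the base divisor `D* = ((g−1)/2)(V_0 + V_0′) + V_0`. -/
noncomputable def DstarOdd (g : ℕ) (c : ℤ → ℝ) : Div :=
  (((g - 1) / 2 : ℕ) : ℤ) •
    (Finsupp.single (V g c 0) (1 : ℤ) + Finsupp.single (conj c (V g c 0)) (1 : ℤ))
  + Finsupp.single (V g c 0) (1 : ℤ)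

end TropicalHyperelliptic

open TropicalHyperelliptic


section Helpers
open Filter Topology

namespace TropicalHyperelliptic

lemma ev_iff (p : ℝ → Prop) :
    (∃ ε > (0 : ℝ), ∀ t : ℝ, 0 < t → t < ε → p t) ↔ ∀ᶠ t in 𝓝[>] (0 : ℝ), p t := by
  rw [Filter.Eventually, mem_nhdsGT_iff_exists_Ioo_subset]
  constructor
  · rintro ⟨ε, h, H⟩
    exact ⟨ε, h, fun t ht => H t ht.1 ht.2⟩
  · rintro ⟨ε, h, H⟩
    exact ⟨ε, h, fun t h1 h2 => H ⟨h1, h2⟩⟩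

lemma localDirs_iff {S : Set (ℝ × ℝ)} {P : ℝ × ℝ} {v : ℤ × ℤ} :
    v ∈ localDirs S P ↔ IsCoprime v.1 v.2 ∧ ∀ᶠ t in 𝓝[>] (0 : ℝ), P + t • vr v ∈ S := by
  rw [← ev_iff]; rfl

lemma hasSlope_iff {S : Set (ℝ × ℝ)} {f : ℝ × ℝ → ℝ} {P : ℝ × ℝ} {v : ℤ × ℤ} {s : ℤ} :
    HasSlope S f P v s ↔ ∀ᶠ t in 𝓝[>] (0 : ℝ), P + t • vr v ∈ S →
      f (P + t • vr v) = f P + (s : ℝ) * t := by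
  rw [← ev_iff]
  constructor
  · rintro ⟨ε, h, H⟩
    exact ⟨ε, h, fun t h1 h2 => H t h1.le h2⟩
  · rintro ⟨ε, h, H⟩
    refine ⟨ε, h, fun t h1 h2 => ?_⟩
    rcases h1.eq_or_lt with rfl | h1
    · intro; simp
    · exact H t h1 h2

lemma slope_eq {S : Set (ℝ × ℝ)} {f : ℝ × ℝ → ℝ} {P : ℝ × ℝ} {v : ℤ × ℤ} {s : ℤ}
    (hv : v ∈ localDirs S P) (h : HasSlope S f P v s) : slope S f P v = s := by
  have hex : ∃ s : ℤ, HasSlope S f P v s := ⟨s, h⟩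
  unfold slope
  rw [dif_pos hex]
  have h1 := hasSlope_iff.1 hex.choose_spec
  have h2 := hasSlope_iff.1 h
  have h3 := (localDirs_iff.1 hv).2
  obtain ⟨t, h1, h2, h3, h4⟩ :=
    (h1.and (h2.and (h3.and (self_mem_nhdsWithin : Set.Ioi (0 : ℝ) ∈ 𝓝[>] (0 : ℝ))))).exists
  have h5 := (h1 h3).symm.trans (h2 h3)
  have h4 : (0 : ℝ) < t := h4
  have h6 : ((hex.choose : ℤ) : ℝ) = s := by
    have := add_left_cancel h5
    exact mul_right_cancel₀ h4.ne' this
  exact_mod_cast h6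

lemma HasSlope.add {S : Set (ℝ × ℝ)} {f f' : ℝ × ℝ → ℝ} {P : ℝ × ℝ} {v : ℤ × ℤ} {s s' : ℤ}
    (h : HasSlope S f P v s) (h' : HasSlope S f' P v s') :
    HasSlope S (f + f') P v (s + s') := by
  rw [hasSlope_iff] at *
  filter_upwards [h, h'] with t h1 h2 h3
  simp only [Pi.add_apply]
  rw [h1 h3, h2 h3]; push_cast; ring

lemma ord_eq_sum {S : Set (ℝ × ℝ)} {f : ℝ × ℝ → ℝ} {P : ℝ × ℝ} {T : Finset (ℤ × ℤ)}
    (hT : localDirs S P = ↑T) : ord S f P = ∑ v ∈ T, slope S f P v := by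
  unfold ord
  rw [hT, finsum_mem_coe_finset]

lemma IsPrincipal.add {S : Set (ℝ × ℝ)} (hfin : ∀ P, (localDirs S P).Finite)
    (hcl : ∀ P, (localDirs S P).Nonempty → P ∈ S) {D D' : Div}
    (h : IsPrincipal S D) (h' : IsPrincipal S D') : IsPrincipal S (D + D') := by
  obtain ⟨f, hf, hD⟩ := h
  obtain ⟨f', hf', hD'⟩ := h'
  refine ⟨f + f', ⟨hf.cont.add hf'.cont, ?_⟩, ?_⟩
  · intro P hP v hv
    obtain ⟨s, hs⟩ := hf.slope_int P hP v hv
    obtain ⟨s', hs'⟩ := hf'.slope_int P hP v hv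
    exact ⟨_, hs.add hs'⟩
  · intro P
    rw [Finsupp.add_apply, hD, hD']
    have hT : localDirs S P = ↑(hfin P).toFinset := by simp
    rw [ord_eq_sum hT, ord_eq_sum hT, ord_eq_sum hT, ← Finset.sum_add_distrib]
    refine Finset.sum_congr rfl fun v hv => ?_
    have hv : v ∈ localDirs S P := by simpa using hv
    have hP := hcl P ⟨v, hv⟩
    obtain ⟨s, hs⟩ := hf.slope_int P hP v hv
    obtain ⟨s', hs'⟩ := hf'.slope_int P hP v hv
    rw [slope_eq hv hs, slope_eq hv hs', slope_eq hv (hs.add hs')]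

lemma isPrincipal_zero {S : Set (ℝ × ℝ)} : IsPrincipal S 0 := by
  have h0 : ∀ P v, HasSlope S (fun _ => 0) P v 0 := fun P v => ⟨1, one_pos, by simp⟩
  refine ⟨fun _ => 0, ⟨continuousOn_const, fun P _ v _ => ⟨0, h0 P v⟩⟩, fun P => ?_⟩
  unfold ord
  symm
  rw [Finsupp.zero_apply]
  exact finsum_mem_eq_zero_of_forall_eq_zero fun v hv => slope_eq hv (h0 P v)

lemma IsPrincipal.sum {S : Set (ℝ × ℝ)} (hfin : ∀ P, (localDirs S P).Finite)
    (hcl : ∀ P, (localDirs S P).Nonempty → P ∈ S) {ι : Type*} (s : Finset ι) (D : ι → Div)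
    (h : ∀ i ∈ s, IsPrincipal S (D i)) : IsPrincipal S (∑ i ∈ s, D i) :=
  Finset.sum_induction _ (IsPrincipal S) (fun _ _ h h' => IsPrincipal.add hfin hcl h h')
    isPrincipal_zero h

/-! ### Abstract ladder graphs -/

/-- The ladder graph. -/
def Gm (m b0 : ℝ) (R : ℝ → ℝ) (B : Set ℝ) : Set (ℝ × ℝ) :=
  {P | b0 ≤ P.1 ∧ P.1 ≤ 0 ∧ (|P.2 - m| = R P.1 ∨ P.1 ∈ B ∧ |P.2 - m| ≤ R P.1)}

/-- Assumptions on the ladder data. -/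
structure LData (b0 : ℝ) (R : ℝ → ℝ) (B : Set ℝ) : Prop where
  pos : ∀ X, 0 < R X
  cont : Continuous R
  fin : B.Finite
  side : ∀ X, b0 ≤ X → X ≤ 0 → ∀ τ : ℤ, τ = 1 ∨ τ = -1 →
    ∃ r : ℤ, ∀ᶠ t in 𝓝[>] (0 : ℝ), R (X + τ * t) = R X + r * t

variable {m b0 : ℝ} {R : ℝ → ℝ} {B : Set ℝ}

lemma LData.closed (h : LData b0 R B) : IsClosed (Gm m b0 R B) := by
  have hR := h.cont
  have hB := h.fin.isClosed
  refine IsClosed.inter (isClosed_le continuous_const continuous_fst) ?_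
  refine IsClosed.inter (isClosed_le continuous_fst continuous_const) ?_
  refine IsClosed.union (isClosed_eq (by fun_prop) (by fun_prop)) ?_
  have h2 : IsClosed {P : ℝ × ℝ | |P.2 - m| ≤ R P.1} := isClosed_le (by fun_prop) (by fun_prop)
  exact IsClosed.inter (hB.preimage continuous_fst) h2

lemma tendsto_ray (P : ℝ × ℝ) (v : ℤ × ℤ) :
    Tendsto (fun t : ℝ => P + t • vr v) (𝓝[>] 0) (𝓝 P) := by
  have : Continuous (fun t : ℝ => P + t • vr v) := by fun_prop
  have h2 := this.tendsto 0
  simp only [zero_smul, add_zero] at h2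
  exact h2.mono_left nhdsWithin_le_nhds

lemma LData.hcl (h : LData b0 R B) (P : ℝ × ℝ) (hP : (localDirs (Gm m b0 R B) P).Nonempty) :
    P ∈ Gm m b0 R B := by
  obtain ⟨v, hv⟩ := hP
  exact h.closed.mem_of_tendsto (tendsto_ray P v) (localDirs_iff.1 hv).2

lemma pos_ev : ∀ᶠ t in 𝓝[>] (0 : ℝ), 0 < t := self_mem_nhdsWithin

lemma small_ev {e : ℝ} (he : 0 < e) (k : ℝ) : ∀ᶠ t in 𝓝[>] (0 : ℝ), k * t < e := by
  have h : Continuous fun t : ℝ => k * t := by fun_prop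
  have := h.tendsto 0
  rw [mul_zero] at this
  exact (this.mono_left nhdsWithin_le_nhds).eventually (gt_mem_nhds he)

lemma LData.notB (h : LData b0 R B) (X : ℝ) : ∀ᶠ x in 𝓝 X, x ≠ X → x ∉ B := by
  have hc : IsClosed (B \ {X}) := (h.fin.subset Set.sdiff_subset).isClosed
  have := hc.isOpen_compl.mem_nhds (x := X) (by simp)
  filter_upwards [this] with x hx hne hxB
  exact hx ⟨hxB, hne⟩

lemma LData.notB' (h : LData b0 R B) (X : ℝ) (k : ℝ) (hk : k ≠ 0) :
    ∀ᶠ t in 𝓝[>] (0 : ℝ), X + k * t ∉ B := by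
  have hc : Continuous fun t : ℝ => X + k * t := by fun_prop
  have := hc.tendsto 0
  simp only [mul_zero, add_zero] at this
  filter_upwards [(this.mono_left nhdsWithin_le_nhds).eventually (h.notB X), pos_ev] with t ht ht0
  apply ht
  intro h
  have : k * t = 0 := by linarith
  rcases mul_eq_zero.1 this with h | h
  · exact hk h
  · exact ht0.ne' h

lemma scale_ev {k : ℝ} (hk : 0 < k) {p : ℝ → Prop} (h : ∀ᶠ t in 𝓝[>] (0 : ℝ), p t) :
    ∀ᶠ t in 𝓝[>] (0 : ℝ), p (k * t) := by
  rw [← ev_iff] at *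
  obtain ⟨e, he, H⟩ := h
  refine ⟨e / k, by positivity, fun t h1 h2 => H _ (by positivity) ?_⟩
  rw [lt_div_iff₀ hk] at h2
  linarith

/-- `X` can be moved in direction `τ` inside the strip. -/
def stripc (b0 X : ℝ) (τ : ℤ) : Prop := (τ = 1 ∧ X < 0) ∨ (τ = -1 ∧ b0 < X)

lemma strip_ev {X : ℝ} (h0 : b0 ≤ X) (h1 : X ≤ 0) {τ : ℤ} (h : stripc b0 X τ) :
    ∀ᶠ t in 𝓝[>] (0 : ℝ), b0 ≤ X + τ * t ∧ X + τ * t ≤ 0 := by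
  rcases h with ⟨rfl, h⟩ | ⟨rfl, h⟩
  · filter_upwards [small_ev (e := -X) (by linarith) 1, pos_ev] with t h1 h2
    push_cast
    constructor <;> linarith
  · filter_upwards [small_ev (e := X - b0) (by linarith) 1, pos_ev] with t h1 h2
    push_cast
    constructor <;> linarith

/-- the rule for horizontal directions -/
lemma LData.hor (h : LData b0 R B) {X : ℝ} {y : ℝ} {v : ℤ × ℤ}
    (hv : v ∈ localDirs (Gm m b0 R B) (X, m + y)) {τ : ℤ} (hτ : τ = 1 ∨ τ = -1)
    (hvτ : 0 < v.1 * τ) {r : ℤ} (hr : ∀ᶠ t in 𝓝[>] (0 : ℝ), R (X + τ * t) = R X + r * t) :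
    stripc b0 X τ ∧ ∀ᶠ t in 𝓝[>] (0 : ℝ), |y + t * v.2| = R X + r * ((v.1 * τ : ℤ) * t) := by
  have hk : (0 : ℝ) < ((v.1 * τ : ℤ) : ℝ) := by exact_mod_cast hvτ
  have hv1 : (v.1 : ℝ) ≠ 0 := by
    intro hh
    have : v.1 = 0 := by exact_mod_cast hh
    simp [this] at hvτ
  have hmem := (localDirs_iff.1 hv).2
  have hτ2 : (τ : ℝ) * τ = 1 := by rcases hτ with rfl | rfl <;> norm_num
  constructor
  · obtain ⟨t, ht, ht0⟩ := (hmem.and pos_ev).exists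
    obtain ⟨ha, hb, -⟩ := ht
    simp only [vr, Prod.fst_add, Prod.smul_fst, smul_eq_mul] at ha hb
    have hp : (0 : ℝ) < t * ((v.1 * τ : ℤ) : ℝ) := by positivity
    rcases hτ with rfl | rfl
    · left
      push_cast at hp
      exact ⟨rfl, by linarith⟩
    · right
      push_cast at hp
      exact ⟨rfl, by linarith⟩
  · filter_upwards [hmem, scale_ev hk hr, h.notB' X v.1 hv1, pos_ev] with t ht h2 h3 h4
    obtain ⟨-, -, ht⟩ := ht
    simp only [vr, Prod.fst_add, Prod.smul_fst, smul_eq_mul, Prod.snd_add, Prod.smul_snd] at ht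
    have e1 : X + t * (v.1 : ℝ) = X + v.1 * t := by ring
    have e2 : X + (τ : ℝ) * (((v.1 * τ : ℤ) : ℝ) * t) = X + v.1 * t := by
      push_cast
      linear_combination (v.1 * t : ℝ) * hτ2
    rw [e1] at ht
    rw [e2] at h2
    rw [← h2]
    rcases ht with ht | ht
    · rw [← ht]; congr 1; ring
    · exact absurd ht.1 h3


lemma LData.top_hor (h : LData b0 R B) {X : ℝ} {v : ℤ × ℤ} {σ : ℤ} (hσ : σ = 1 ∨ σ = -1)
    (hv : v ∈ localDirs (Gm m b0 R B) (X, m + σ * R X)) {τ : ℤ} (hτ : τ = 1 ∨ τ = -1)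
    (hvτ : 0 < v.1 * τ) {r : ℤ} (hr : ∀ᶠ t in 𝓝[>] (0 : ℝ), R (X + τ * t) = R X + r * t) :
    stripc b0 X τ ∧ v = (τ, σ * r) := by
  obtain ⟨h1, h2⟩ := h.hor hv hτ hvτ hr
  refine ⟨h1, ?_⟩
  obtain ⟨t, ht, ht1, ht0⟩ := (h2.and ((small_ev (h.pos X) (-(σ * v.2 : ℝ))).and pos_ev)).exists
  have hσ2 : (σ : ℝ) * σ = 1 := by rcases hσ with rfl | rfl <;> norm_num
  have e : |(σ : ℝ) * R X + t * v.2| = R X + σ * v.2 * t := by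
    have e1 : (σ : ℝ) * R X + t * v.2 = σ * (R X + σ * v.2 * t) := by
      linear_combination (-(v.2 * t) : ℝ) * hσ2
    have e2 : |(σ : ℝ)| = 1 := by rcases hσ with rfl | rfl <;> norm_num
    rw [e1, abs_mul, e2, one_mul, abs_of_pos]
    linarith
  rw [e] at ht
  have e3 : ((σ * v.2 : ℤ) : ℝ) = ((r * (v.1 * τ) : ℤ) : ℝ) := by
    push_cast
    push_cast at ht
    have : ((σ : ℝ) * v.2 - r * (v.1 * τ)) * t = 0 := by linarith
    rcases mul_eq_zero.1 this with h | h
    · linarith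
    · exact absurd h ht0.ne'
  have e4 : σ * v.2 = r * (v.1 * τ) := by exact_mod_cast e3
  have hcop := (localDirs_iff.1 hv).1
  have hd : v.1 ∣ v.2 := by
    rcases hσ with rfl | rfl
    · exact ⟨r * τ, by linear_combination e4⟩
    · exact ⟨-(r * τ), by linear_combination -e4⟩
  have hu : IsUnit v.1 := hcop.isUnit_of_dvd' dvd_rfl hd
  rcases Int.isUnit_iff.1 hu with hv1 | hv1 <;> rw [hv1] at hvτ e4 <;>
    rcases hτ with rfl | rfl <;> rcases hσ with rfl | rfl <;> simp at hvτ <;>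
    refine Prod.ext ?_ ?_ <;> simp <;> linarith

lemma LData.top_hor_mem (h : LData b0 R B) {X : ℝ} (h0 : b0 ≤ X) (h1 : X ≤ 0)
    {σ : ℤ} (hσ : σ = 1 ∨ σ = -1)
    {τ : ℤ} (hτ : τ = 1 ∨ τ = -1) (hs : stripc b0 X τ)
    {r : ℤ} (hr : ∀ᶠ t in 𝓝[>] (0 : ℝ), R (X + τ * t) = R X + r * t) :
    (τ, σ * r) ∈ localDirs (Gm m b0 R B) (X, m + σ * R X) := by
  rw [localDirs_iff]
  constructor
  · rcases hτ with rfl | rfl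
    · exact isCoprime_one_left
    · exact isCoprime_one_left.neg_left
  · filter_upwards [strip_ev h0 h1 hs, hr] with t ht1 ht2
    have e1 : X + t * (τ : ℝ) = X + τ * t := by ring
    refine ⟨?_, ?_, Or.inl ?_⟩ <;>
      simp only [vr, Prod.fst_add, Prod.smul_fst, smul_eq_mul, Prod.snd_add, Prod.smul_snd, e1]
    · exact ht1.1
    · exact ht1.2
    · have e2 : |(σ : ℝ)| = 1 := by rcases hσ with rfl | rfl <;> norm_num
      have e3 : m + (σ : ℝ) * R X + t * ((σ * r : ℤ) : ℝ) - m = σ * R (X + τ * t) := by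
        rw [ht2]; push_cast; ring
      rw [e3, abs_mul, e2, one_mul, abs_of_pos (h.pos _)]

lemma vert_cop {v : ℤ × ℤ} (hc : IsCoprime v.1 v.2) (h0 : v.1 = 0) :
    v = (0, 1) ∨ v = (0, -1) := by
  rw [h0, isCoprime_zero_left, Int.isUnit_iff] at hc
  rcases hc with hc | hc
  · exact Or.inl (Prod.ext h0 hc)
  · exact Or.inr (Prod.ext h0 hc)

lemma LData.top_vert (h : LData b0 R B) {X : ℝ} (h0 : b0 ≤ X) (h1 : X ≤ 0)
    {v : ℤ × ℤ} {σ : ℤ} (hσ : σ = 1 ∨ σ = -1) (hv0 : v.1 = 0) :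
    v ∈ localDirs (Gm m b0 R B) (X, m + σ * R X) ↔ v = (0, -σ) ∧ X ∈ B := by
  have hσ2 : (σ : ℝ) * σ = 1 := by rcases hσ with rfl | rfl <;> norm_num
  have e2 : |(σ : ℝ)| = 1 := by rcases hσ with rfl | rfl <;> norm_num
  have key : ∀ t k : ℝ, |m + (σ : ℝ) * R X + t * (σ * k) - m| = |R X + t * k| := by
    intro t k
    have : m + (σ : ℝ) * R X + t * (σ * k) - m = σ * (R X + t * k) := by ring
    rw [this, abs_mul, e2, one_mul]
  have hR := h.pos X
  constructor
  · intro hv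
    obtain ⟨hc, hmem⟩ := localDirs_iff.1 hv
    have hv : v = (0, σ) ∨ v = (0, -σ) := by
      rcases vert_cop hc hv0 with rfl | rfl <;> rcases hσ with rfl | rfl <;> simp
    obtain ⟨t, ⟨-, -, ht⟩, ht1, ht0⟩ := (hmem.and ((small_ev hR 1).and pos_ev)).exists
    rcases hv with rfl | rfl
    · exfalso
      simp only [vr, Prod.fst_add, Prod.smul_fst, smul_eq_mul, Prod.snd_add, Prod.smul_snd,
        Int.cast_zero, mul_zero, add_zero] at ht
      have := key t 1
      rw [mul_one, mul_one, abs_of_pos (a := R X + t) (by linarith)] at this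
      rw [this] at ht
      rcases ht with ht | ht
      · linarith
      · linarith [ht.2]
    · refine ⟨rfl, ?_⟩
      simp only [vr, Prod.fst_add, Prod.smul_fst, smul_eq_mul, Prod.snd_add, Prod.smul_snd,
        Int.cast_zero, mul_zero, add_zero] at ht
      have := key t (-1)
      rw [mul_neg_one, mul_neg_one, abs_of_pos (a := R X + -t) (by linarith)] at this
      push_cast at ht
      rw [this] at ht
      rcases ht with ht | ht
      · linarith
      · exact ht.1
  · rintro ⟨rfl, hB⟩
    rw [localDirs_iff]
    constructor
    · rw [isCoprime_zero_left, Int.isUnit_iff]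
      rcases hσ with rfl | rfl <;> simp
    · filter_upwards [small_ev hR 1, pos_ev] with t ht ht0
      have := key t (-1)
      rw [mul_neg_one, mul_neg_one, abs_of_pos (a := R X + -t) (by linarith)] at this
      refine ⟨?_, ?_, Or.inr ⟨?_, ?_⟩⟩ <;>
      simp only [vr, Prod.fst_add, Prod.smul_fst, smul_eq_mul, Prod.snd_add, Prod.smul_snd,
        Int.cast_zero, mul_zero, add_zero, Int.cast_neg]
      · exact h0
      · exact h1
      · exact hB
      · rw [this]; linarith

lemma LData.int_hor (h : LData b0 R B) {X : ℝ} (h0 : b0 ≤ X) (h1 : X ≤ 0) {y : ℝ}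
    (hy : |y| < R X) {v : ℤ × ℤ} (hv : v ∈ localDirs (Gm m b0 R B) (X, m + y)) : v.1 = 0 := by
  by_contra hne
  have : ∃ τ : ℤ, (τ = 1 ∨ τ = -1) ∧ 0 < v.1 * τ := by
    rcases lt_or_gt_of_ne hne with h | h
    · exact ⟨-1, by simp, by linarith⟩
    · exact ⟨1, by simp, by linarith⟩
  obtain ⟨τ, hτ, hvτ⟩ := this
  obtain ⟨r, hr⟩ := h.side X h0 h1 τ hτ
  obtain ⟨-, h2⟩ := h.hor hv hτ hvτ hr
  obtain ⟨t, ht, ht1, ht0⟩ := (h2.and ((small_ev (e := R X - |y|) (by linarith)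
    (|(v.2 : ℝ)| - r * (v.1 * τ : ℤ))).and pos_ev)).exists
  have := abs_add_le y (t * v.2)
  rw [abs_mul, abs_of_pos ht0] at this
  linarith

lemma LData.int_dirs (h : LData b0 R B) {X : ℝ} (h0 : b0 ≤ X) (h1 : X ≤ 0) {y : ℝ}
    (hy : |y| < R X) (hB : X ∈ B) :
    localDirs (Gm m b0 R B) (X, m + y) = ↑({(0, 1), (0, -1)} : Finset (ℤ × ℤ)) := by
  ext v
  simp only [Finset.coe_insert, Finset.coe_singleton, Set.mem_insert_iff, Set.mem_singleton_iff]
  constructor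
  · intro hv
    exact vert_cop (localDirs_iff.1 hv).1 (h.int_hor h0 h1 hy hv)
  · intro hv
    rw [localDirs_iff]
    constructor
    · rcases hv with rfl | rfl <;> rw [isCoprime_zero_left, Int.isUnit_iff] <;> simp
    · filter_upwards [small_ev (e := R X - |y|) (by linarith) 1, pos_ev] with t ht ht0
      have hv1 : v.1 = 0 := by rcases hv with rfl | rfl <;> rfl
      have hv2 : |(v.2 : ℝ)| = 1 := by rcases hv with rfl | rfl <;> simp
      refine ⟨?_, ?_, Or.inr ⟨?_, ?_⟩⟩ <;>
      simp only [vr, Prod.fst_add, Prod.smul_fst, smul_eq_mul, Prod.snd_add, Prod.smul_snd,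
        hv1, Int.cast_zero, mul_zero, add_zero]
      · exact h0
      · exact h1
      · exact hB
      · have := abs_add_le y (t * v.2)
        rw [abs_mul, abs_of_pos ht0, hv2] at this
        have e : m + y + t * (v.2 : ℝ) - m = y + t * v.2 := by ring
        rw [e]
        linarith

open scoped Classical in
lemma mem_ite_single {p : Prop} {v w : ℤ × ℤ} :
    v ∈ (if p then {w} else ∅ : Finset (ℤ × ℤ)) ↔ p ∧ v = w := by
  by_cases h : p <;> simp [h]

open scoped Classical in
lemma LData.top_dirs (h : LData b0 R B) {X : ℝ} (h0 : b0 ≤ X) (h1 : X ≤ 0)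
    {σ : ℤ} (hσ : σ = 1 ∨ σ = -1) : ∃ p q : ℤ,
    localDirs (Gm m b0 R B) (X, m + σ * R X) =
      ↑((if b0 < X then {(-1, p)} else ∅) ∪ ((if X < 0 then {(1, q)} else ∅) ∪
        (if X ∈ B then {(0, -σ)} else ∅)) : Finset (ℤ × ℤ)) := by
  obtain ⟨p, hp⟩ := h.side X h0 h1 (-1) (by simp)
  obtain ⟨q, hq⟩ := h.side X h0 h1 1 (by simp)
  refine ⟨σ * p, σ * q, ?_⟩
  ext v
  have hm : v ∈ ((if b0 < X then {(-1, σ * p)} else ∅) ∪ ((if X < 0 then {(1, σ * q)} else ∅) ∪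
        (if X ∈ B then {(0, -σ)} else ∅)) : Finset (ℤ × ℤ)) ↔
      (b0 < X ∧ v = (-1, σ * p)) ∨ (X < 0 ∧ v = (1, σ * q)) ∨ (v = (0, -σ) ∧ X ∈ B) := by
    rw [Finset.mem_union, Finset.mem_union, mem_ite_single, mem_ite_single, mem_ite_single,
      and_comm (a := X ∈ B)]
  rw [Finset.mem_coe, hm]
  constructor
  · intro hv
    rcases lt_trichotomy v.1 0 with h2 | h2 | h2
    · left
      have := h.top_hor hσ hv (τ := -1) (by simp) (by linarith) hp
      exact ⟨by simpa [stripc] using this.1, this.2⟩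
    · right; right
      exact (h.top_vert h0 h1 hσ h2).1 hv
    · right; left
      have := h.top_hor hσ hv (τ := 1) (by simp) (by linarith) hq
      exact ⟨by simpa [stripc] using this.1, this.2⟩
  · rintro (⟨ha, rfl⟩ | ⟨ha, rfl⟩ | hv)
    · exact h.top_hor_mem h0 h1 hσ (by simp) (by simpa [stripc] using ha) hp
    · exact h.top_hor_mem h0 h1 hσ (by simp) (by simpa [stripc] using ha) hq
    · exact (h.top_vert h0 h1 hσ (by rw [hv.1])).2 hv

/-- every point of the ladder is an end point or an inner point of a rung -/
lemma Gm_cases {P : ℝ × ℝ} (hP : P ∈ Gm m b0 R B) :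
    b0 ≤ P.1 ∧ P.1 ≤ 0 ∧ ((∃ σ : ℤ, (σ = 1 ∨ σ = -1) ∧ P = (P.1, m + σ * R P.1)) ∨
      (P.1 ∈ B ∧ |P.2 - m| < R P.1 ∧ P = (P.1, m + (P.2 - m)))) := by
  obtain ⟨h0, h1, h2⟩ := hP
  refine ⟨h0, h1, ?_⟩
  have key : |P.2 - m| = R P.1 → ∃ σ : ℤ, (σ = 1 ∨ σ = -1) ∧ P = (P.1, m + σ * R P.1) := by
    intro h
    rcases abs_choice (P.2 - m) with h3 | h3
    · exact ⟨1, by simp, Prod.ext rfl (by rw [← h, h3]; push_cast; ring)⟩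
    · exact ⟨-1, by simp, Prod.ext rfl (by rw [← h, h3]; push_cast; ring)⟩
  rcases h2 with h2 | ⟨h2, h3⟩
  · exact Or.inl (key h2)
  · rcases h3.eq_or_lt with h3 | h3
    · exact Or.inl (key h3)
    · exact Or.inr ⟨h2, h3, Prod.ext rfl (by ring)⟩

lemma LData.dirs_finite (h : LData b0 R B) (P : ℝ × ℝ) :
    (localDirs (Gm m b0 R B) P).Finite := by
  by_cases hP : P ∈ Gm m b0 R B
  · obtain ⟨h0, h1, ⟨σ, hσ, he⟩ | ⟨hB, hy, he⟩⟩ := Gm_cases hP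
    · obtain ⟨p, q, hd⟩ := h.top_dirs (m := m) h0 h1 hσ
      rw [he, hd]
      exact Finset.finite_toSet _
    · rw [he, h.int_dirs h0 h1 hy hB]
      exact Finset.finite_toSet _
  · have : localDirs (Gm m b0 R B) P = ∅ := by
      by_contra hne
      exact hP (h.hcl P (Set.nonempty_iff_ne_empty.2 hne))
    rw [this]
    exact Set.finite_empty

open scoped Classical in
/-- The rational function with zeros `P + P′` and poles `V₀ + V₀′`. -/
noncomputable def fn (m : ℝ) (R : ℝ → ℝ) (a Z : ℝ) (P : ℝ × ℝ) : ℝ :=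
  max (P.1 - a) 0 + if P.1 = a then max |P.2 - m| Z - R a else 0

open scoped Classical in
/-- Slopes of `fn`. -/
noncomputable def sl (a Z X y : ℝ) (v : ℤ × ℤ) : ℤ :=
  if v.1 = 0 then
    (if X = a then (if Z ≤ v.2 * y then 1 else if -Z ≤ v.2 * y then 0 else -1) else 0)
  else (if a < X then v.1 else if X = a then (if v.1 = 1 then 1 else 0) else 0)

lemma max_abs_ev {y Z : ℝ} (hZ : 0 ≤ Z) {w : ℤ} (hw : w = 1 ∨ w = -1) :
    ∀ᶠ t in 𝓝[>] (0 : ℝ), max |y + t * w| Z = max |y| Z +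
      ((if Z ≤ w * y then 1 else if -Z ≤ w * y then 0 else -1 : ℤ) : ℝ) * t := by
  have e0 : |(w : ℝ)| = 1 := by rcases hw with rfl | rfl <;> simp
  have hww : (w : ℝ) * w = 1 := by rcases hw with rfl | rfl <;> norm_num
  have e1 : ∀ t : ℝ, |y + t * w| = |w * y + t| := by
    intro t
    have : (w : ℝ) * y + t = w * (y + t * w) := by linear_combination (-t) * hww
    rw [this, abs_mul, e0, one_mul]
  have e2 : |y| = |w * y| := by rw [abs_mul, e0, one_mul]
  simp_rw [e1]
  rw [e2]
  generalize (w : ℝ) * y = u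
  split_ifs with h1 h2
  · filter_upwards [pos_ev] with t ht
    rw [abs_of_nonneg (by linarith), abs_of_nonneg (by linarith), max_eq_left (by linarith),
      max_eq_left (by linarith)]
    push_cast; ring
  · filter_upwards [pos_ev, small_ev (e := Z - u) (by linarith) 1] with t ht ht1
    rw [max_eq_right (abs_le.2 ⟨by linarith, by linarith⟩),
      max_eq_right (abs_le.2 ⟨by linarith, by linarith⟩)]
    push_cast; ring
  · filter_upwards [pos_ev, small_ev (e := -Z - u) (by linarith) 1] with t ht ht1
    rw [abs_of_nonpos (by linarith), abs_of_nonpos (by linarith), max_eq_left (by linarith),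
      max_eq_left (by linarith)]
    push_cast; ring

lemma fn_slope_vert {S : Set (ℝ × ℝ)} {a Z X y : ℝ} (hZ : 0 ≤ Z) {v : ℤ × ℤ}
    (hv : v = (0, 1) ∨ v = (0, -1)) :
    HasSlope S (fn m R a Z) (X, m + y) v (sl a Z X y v) := by
  rw [hasSlope_iff]
  have hv1 : v.1 = 0 := by rcases hv with rfl | rfl <;> rfl
  have hw : v.2 = 1 ∨ v.2 = -1 := by rcases hv with rfl | rfl <;> simp
  filter_upwards [max_abs_ev (y := y) hZ hw] with t ht _
  simp only [fn, sl, vr, Prod.fst_add, Prod.smul_fst, smul_eq_mul, Prod.snd_add, Prod.smul_snd,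
        hv1, Int.cast_zero, mul_zero, add_zero, if_true]
  have e : m + y + t * (v.2 : ℝ) - m = y + t * v.2 := by ring
  have e' : m + y - m = y := by ring
  rw [e, e']
  by_cases hX : X = a
  · simp only [hX, if_true]
    rw [ht]; ring
  · simp [hX]

lemma fn_slope_hor (h : LData b0 R B) {S : Set (ℝ × ℝ)} {a Z X : ℝ} (hZR : Z ≤ R a) {v : ℤ × ℤ}
    {σ : ℤ} (hσ : σ = 1 ∨ σ = -1) (hv : v.1 = 1 ∨ v.1 = -1) :
    HasSlope S (fn m R a Z) (X, m + σ * R X) v (sl a Z X (σ * R X) v) := by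
  rw [hasSlope_iff]
  have hv0 : v.1 ≠ 0 := by rcases hv with h | h <;> rw [h] <;> norm_num
  have e0 : |(σ : ℝ)| = 1 := by rcases hσ with rfl | rfl <;> simp
  have e' : |m + σ * R X - m| = R X := by
    have : m + σ * R X - m = σ * R X := by ring
    rw [this, abs_mul, e0, one_mul, abs_of_pos (h.pos X)]
  have hfn : fn m R a Z (X, m + σ * R X) = max (X - a) 0 := by
    simp only [fn, e']
    by_cases hX : X = a
    · rw [if_pos hX, hX, max_eq_left hZR]; ring
    · simp [hX]
  rw [hfn]
  have hne : ∀ t : ℝ, X + t * v.1 ≠ a → ∀ y, fn m R a Z (X + t * v.1, y) = max (X + t * v.1 - a) 0 := by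
    intro t ht y
    simp [fn, ht]
  have hp : ∀ t : ℝ, (X, m + σ * R X) + t • vr v = (X + t * v.1, m + σ * R X + t * v.2) := by
    intro t; rfl
  simp_rw [hp]
  have ha : |(v.1 : ℝ)| = 1 := by rcases hv with h | h <;> rw [h] <;> simp
  rcases lt_trichotomy a X with hX | hX | hX
  · filter_upwards [small_ev (e := X - a) (by linarith) (-v.1), pos_ev] with t ht ht0 _
    rw [hne t (by intro hh; linarith), max_eq_left (by linarith), max_eq_left (by linarith)]
    simp only [sl, hv0, if_false, hX, if_true]
    ring
  · subst hX
    filter_upwards [pos_ev] with t ht0 _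
    rw [hne]
    · simp only [sl, hv0, if_false, lt_irrefl, if_true]
      rcases hv with hv | hv
      · simp [hv, ht0.le]
      · simp [hv, ht0.le]
    · rcases hv with hv | hv <;> simp [hv, ht0.ne']
  · filter_upwards [small_ev (e := a - X) (by linarith) (v.1), pos_ev] with t ht ht0 _
    rw [hne t (by intro hh; linarith), max_eq_right (by linarith), max_eq_right (by linarith)]
    simp [sl, hv0, hX.not_gt, hX.ne]

open scoped Classical in
lemma sum_dirs (p1 p2 p3 : Prop) (p q w : ℤ) (F : ℤ × ℤ → ℤ) :
    ∑ v ∈ ((if p1 then {(-1, p)} else ∅) ∪ ((if p2 then {(1, q)} else ∅) ∪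
        (if p3 then {(0, w)} else ∅)) : Finset (ℤ × ℤ)), F v =
      (if p1 then F (-1, p) else 0) + ((if p2 then F (1, q) else 0) +
        (if p3 then F (0, w) else 0)) := by
  rw [Finset.sum_union, Finset.sum_union]
  · by_cases h1 : p1 <;> by_cases h2 : p2 <;> by_cases h3 : p3 <;> simp [h1, h2, h3]
  · rw [Finset.disjoint_left]
    intro v h1 h2
    rw [mem_ite_single] at h1 h2
    have := h1.2.symm.trans h2.2
    simp at this
  · rw [Finset.disjoint_left]
    intro v h1 h2
    rw [Finset.mem_union, mem_ite_single, mem_ite_single] at h2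
    rw [mem_ite_single] at h1
    rcases h2 with h2 | h2
    · have := h1.2.symm.trans h2.2
      simp at this
    · have := h1.2.symm.trans h2.2
      simp at this

lemma fn_slope (h : LData b0 R B) {a Z X y : ℝ} (hZ : 0 ≤ Z) (hZR : Z ≤ R a) {v : ℤ × ℤ}
    (hv : v ∈ localDirs (Gm m b0 R B) (X, m + y)) :
    HasSlope (Gm m b0 R B) (fn m R a Z) (X, m + y) v (sl a Z X y v) := by
  by_cases hv0 : v.1 = 0
  · exact fn_slope_vert hZ (vert_cop (localDirs_iff.1 hv).1 hv0)
  · have hP := h.hcl _ ⟨v, hv⟩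
    obtain ⟨h0, h1, ⟨σ, hσ, he⟩ | ⟨hB, hy, he⟩⟩ := Gm_cases hP
    · have hy : y = σ * R X := by simpa using congrArg Prod.snd he
      subst hy
      refine fn_slope_hor h hZR hσ ?_
      obtain ⟨p, q, hd⟩ := h.top_dirs (m := m) h0 h1 hσ
      rw [hd, Finset.mem_coe, Finset.mem_union, Finset.mem_union, mem_ite_single, mem_ite_single,
        mem_ite_single] at hv
      rcases hv with hv | hv | hv
      · right; rw [hv.2]
      · left; rw [hv.2]
      · rw [hv.2] at hv0; exact absurd rfl hv0
    · exact absurd (h.int_hor h0 h1 (by simpa using hy) hv) hv0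

lemma fn_cont (h : LData b0 R B) {a Z : ℝ} (hZR : Z ≤ R a) :
    ContinuousOn (fn m R a Z) (Gm m b0 R B) := by
  have hR := h.cont
  intro P hP
  by_cases hPa : P.1 = a
  · have hev : ∀ᶠ Q in 𝓝[Gm m b0 R B] P, fn m R a Z Q =
        max (Q.1 - a) 0 + (max |Q.2 - m| Z - max (R Q.1) Z) := by
      have h1 : ∀ᶠ Q in 𝓝 P, Q.1 ≠ a → Q.1 ∉ B := by
        have := h.notB a
        rw [← hPa] at this ⊢
        exact (continuous_fst.tendsto P).eventually this
      filter_upwards [mem_nhdsWithin_of_mem_nhds h1, self_mem_nhdsWithin] with Q hQ hQ2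
      obtain ⟨-, -, hQ3⟩ := hQ2
      by_cases hQa : Q.1 = a
      · simp only [fn, hQa, if_true]
        rw [max_eq_left hZR]
      · simp only [fn, hQa, if_false]
        rcases hQ3 with hQ3 | hQ3
        · rw [hQ3]; ring
        · exact absurd hQ3.1 (hQ hQa)
    have hc : Continuous fun Q : ℝ × ℝ => max (Q.1 - a) 0 + (max |Q.2 - m| Z - max (R Q.1) Z) := by
      fun_prop
    exact hc.continuousWithinAt.congr_of_eventuallyEq hev (hev.self_of_nhdsWithin hP)
  · have hev : ∀ᶠ Q in 𝓝 P, fn m R a Z Q = max (Q.1 - a) 0 := by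
      have : ∀ᶠ Q in 𝓝 P, Q.1 ≠ a := (continuous_fst.tendsto P).eventually (isOpen_ne.mem_nhds hPa)
      filter_upwards [this] with Q hQ
      simp [fn, hQ]
    have hc : Continuous fun Q : ℝ × ℝ => max (Q.1 - a) 0 := by fun_prop
    exact (hc.continuousAt.congr (hev.mono fun _ h => h.symm)).continuousWithinAt

open scoped Classical in
lemma single_ap (A Q : ℝ × ℝ) : (Finsupp.single A (1 : ℤ)) Q = if A = Q then 1 else 0 := by
  rw [Finsupp.single_apply]

theorem principal_pair (h : LData b0 R B) {P P' V0 V0' : ℝ × ℝ} (hP : P ∈ Gm m b0 R B)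
    (hP' : P' = (P.1, 2 * m - P.2)) (hV0 : V0 = (0, m + R 0)) (hV0' : V0' = (0, m - R 0)) :
    IsPrincipal (Gm m b0 R B) (Finsupp.single P 1 + Finsupp.single P' 1 -
      (Finsupp.single V0 1 + Finsupp.single V0' 1)) := by
  obtain ⟨ha0, ha1, ha2⟩ := id hP
  obtain ⟨a, yy⟩ := P
  obtain ⟨y0, rfl⟩ : ∃ y0, yy = m + y0 := ⟨yy - m, by ring⟩
  simp only [add_sub_cancel_left] at ha0 ha1 ha2 hP'
  have hP' : P' = (a, m - y0) := by rw [hP']; congr 1; ring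
  have hZ : 0 ≤ |y0| := abs_nonneg _
  have hZR : |y0| ≤ R a := by
    rcases ha2 with h | h
    · exact h.le
    · exact h.2
  have hneg : ∀ (X y : ℝ), (X, m + y) = P' ↔ X = a ∧ y = -y0 := by
    intro X y
    rw [hP', Prod.ext_iff]
    constructor
    · rintro ⟨h1, h2⟩; exact ⟨h1, by simp at h2; linarith⟩
    · rintro ⟨h1, h2⟩; exact ⟨h1, by simp; linarith⟩
  refine ⟨fn m R a |y0|, ⟨fn_cont h hZR, ?_⟩, ?_⟩
  · rintro ⟨X, y'⟩ hQ v hv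
    obtain ⟨y, rfl⟩ : ∃ y, y' = m + y := ⟨y' - m, by ring⟩
    exact ⟨_, fn_slope h hZ hZR hv⟩
  have hV0m : V0 ∈ Gm m b0 R B := by
    rw [hV0]
    refine ⟨by simpa using ha0.trans ha1, by simp, Or.inl ?_⟩
    simp [abs_of_pos (h.pos 0)]
  have hV0m' : V0' ∈ Gm m b0 R B := by
    rw [hV0']
    refine ⟨by simpa using ha0.trans ha1, by simp, Or.inl ?_⟩
    have : m - R 0 - m = - R 0 := by ring
    simp [this, abs_of_pos (h.pos 0)]
  have hPm' : P' ∈ Gm m b0 R B := by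
    rw [hP']
    refine ⟨ha0, ha1, ?_⟩
    have : m - y0 - m = - y0 := by ring
    simpa [this] using ha2
  have hval : ∀ X y : ℝ, (Finsupp.single (a, m + y0) 1 + Finsupp.single P' 1 -
      (Finsupp.single V0 1 + Finsupp.single V0' 1) : Div) (X, m + y) =
      (if X = a ∧ y = y0 then 1 else 0) + (if X = a ∧ y = -y0 then 1 else 0) -
      ((if X = 0 ∧ y = R 0 then 1 else 0) + (if X = 0 ∧ y = -R 0 then 1 else 0)) := by
    intro X y
    simp only [Finsupp.sub_apply, Finsupp.add_apply, single_ap, eq_comm (b := (X, m + y)), hneg]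
    rw [hV0, hV0']
    simp only [Prod.mk.injEq, add_right_inj]
    have : ∀ z : ℝ, (m + y = m - z) ↔ y = -z := fun z => by
      constructor <;> intro h <;> linarith
    simp only [this]
  rintro ⟨X, y'⟩
  obtain ⟨y, rfl⟩ : ∃ y, y' = m + y := ⟨y' - m, by ring⟩
  by_cases hQ : (X, m + y) ∈ Gm m b0 R B
  swap
  · have hem : localDirs (Gm m b0 R B) (X, m + y) = ↑(∅ : Finset (ℤ × ℤ)) := by
      by_contra hne
      exact hQ (h.hcl _ (Set.nonempty_iff_ne_empty.2 (by simpa using hne)))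
    rw [ord_eq_sum hem]
    have hn : ∀ A ∈ Gm m b0 R B, A ≠ (X, m + y) := fun A hA he => hQ (he ▸ hA)
    simp only [Finsupp.sub_apply, Finsupp.add_apply, single_ap, if_neg (hn _ hP),
      if_neg (hn _ hPm'), if_neg (hn _ hV0m), if_neg (hn _ hV0m')]
    simp
  rw [hval]
  have hord : ∀ T : Finset (ℤ × ℤ), localDirs (Gm m b0 R B) (X, m + y) = ↑T →
      ord (Gm m b0 R B) (fn m R a |y0|) (X, m + y) = ∑ v ∈ T, sl a |y0| X y v := by
    intro T hT
    rw [ord_eq_sum hT]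
    refine Finset.sum_congr rfl fun v hv => ?_
    have hv : v ∈ localDirs (Gm m b0 R B) (X, m + y) := by rw [hT]; exact hv
    exact slope_eq hv (fn_slope h hZ hZR hv)
  obtain ⟨h0, h1, ⟨σ, hσ, he⟩ | ⟨hB, hy, he⟩⟩ := Gm_cases hQ
  · have hy : y = σ * R X := by simpa using congrArg Prod.snd he
    subst hy
    obtain ⟨p, q, hd⟩ := h.top_dirs (m := m) h0 h1 hσ
    rw [hord _ hd, sum_dirs]
    simp only at h0 h1
    have hRX := h.pos X
    have hR0 := h.pos 0
    have hab : (|y0| = y0 ∧ 0 ≤ y0) ∨ (|y0| = -y0 ∧ y0 ≤ 0) := by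
      rcases le_total 0 y0 with h | h
      · exact Or.inl ⟨abs_of_nonneg h, h⟩
      · exact Or.inr ⟨abs_of_nonpos h, h⟩
    clear hord hd he hQ hval hP hPm' hV0m hV0m' hneg hP' hV0 hV0'; clear hP'
    generalize |y0| = Z at *
    have hcs : X = a → R X = R a := fun h => by rw [h]
    have hcs0 : X = 0 → R X = R 0 := fun h => by rw [h]
    generalize hA : R X = RX at *
    generalize hB : R a = Ra at *
    generalize hC : R 0 = R0 at *
    have hBa : X = a → (X ∈ B ↔ a ∈ B) := fun h => by rw [h]
    clear hA hB hC h
    generalize (X ∈ B) = pX at *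
    generalize (a ∈ B) = pa at *
    simp only [sl]
    clear P' V0 V0'
    have hn1 : RX ≠ -R0 := by intro h; linarith
    have hn2 : -RX ≠ R0 := by intro h; linarith
    rcases hσ with rfl | rfl <;> push_cast <;> simp only [one_mul, neg_mul, hn1, hn2, and_false, if_false] <;> grind (splits := 40)
  · simp only [add_sub_cancel_left] at hy h0 h1 hB
    rw [hord _ (h.int_dirs h0 h1 hy hB), Finset.sum_pair (by decide)]
    simp only [sl, if_true]
    have hab : (|y0| = y0 ∧ 0 ≤ y0) ∨ (|y0| = -y0 ∧ y0 ≤ 0) := by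
      rcases le_total 0 y0 with h | h
      · exact Or.inl ⟨abs_of_nonneg h, h⟩
      · exact Or.inr ⟨abs_of_nonpos h, h⟩
    obtain ⟨hy1, hy2⟩ := abs_lt.1 hy
    have e1 : ¬ (X = 0 ∧ y = R 0) := by
      rintro ⟨rfl, h⟩; linarith
    have e2 : ¬ (X = 0 ∧ y = -R 0) := by
      rintro ⟨rfl, h⟩; linarith
    rw [if_neg e1, if_neg e2]
    clear hord he hQ hval hP hPm' hV0m hV0m' hneg hP' hV0 hV0' e1 e2 ha2 h hB hy hy1 hy2 hZR
    generalize |y0| = Z at *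
    push_cast
    grind

/-! ### The concrete curve -/

/-- The break points of `P̃`. -/
noncomputable def bb (c : ℤ → ℝ) (j : ℕ) : ℝ := c (j : ℤ) - c ((j : ℤ) + 1)

/-- The set of break points. -/
def BB (g : ℕ) (c : ℤ → ℝ) : Set ℝ := {x | ∃ i : ℕ, i ≤ g ∧ x = bb c i}

lemma bb_succ {g : ℕ} {c : ℤ → ℝ} (hc : Hyp g c) {i : ℕ} (hi : i < g) : bb c i < bb c (i + 1) := by
  obtain ⟨h1, h2, h3, h4, h5⟩ := hc
  unfold bb
  push_cast
  rcases Nat.lt_or_ge (i + 1) g with h | h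
  · have := h4 i (by omega)
    have e : (i : ℤ) + 1 + 1 = i + 2 := by ring
    rw [e]; linarith
  · have e : (i : ℤ) = (g : ℤ) - 1 := by omega
    rw [e, sub_add_cancel, h1, h2]
    linarith

lemma bb_lt {g : ℕ} {c : ℤ → ℝ} (hc : Hyp g c) {i j : ℕ} (hij : i < j) (hj : j ≤ g) :
    bb c i < bb c j := by
  induction j, hij using Nat.le_induction with
  | base => exact bb_succ hc hj
  | succ k hk ih => exact (ih (by omega)).trans (bb_succ hc (by omega))

lemma bb_le {g : ℕ} {c : ℤ → ℝ} (hc : Hyp g c) {i j : ℕ} (hij : i ≤ j) (hj : j ≤ g) :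
    bb c i ≤ bb c j := by
  rcases hij.eq_or_lt with rfl | h
  · exact le_rfl
  · exact (bb_lt hc h hj).le

lemma Ptilde_eq {g : ℕ} {c : ℤ → ℝ} {X : ℝ} {i : ℕ} (hi : i ≤ g + 1)
    (h1 : ∀ j < i, bb c j ≤ X) (h2 : ∀ j, i ≤ j → j ≤ g → X ≤ bb c j) :
    Ptilde g c X = c (i : ℤ) + i * X := by
  unfold Ptilde
  have up : ∀ j, i ≤ j → j ≤ g + 1 → c (j : ℤ) + (j : ℝ) * X ≤ c (i : ℤ) + i * X := by
    intro j hj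
    induction j, hj using Nat.le_induction with
    | base => intro; exact le_rfl
    | succ k hk ih =>
      intro hk2
      have := ih (by omega)
      have h3 := h2 k hk (by omega)
      unfold bb at h3
      push_cast
      linarith
  have dn : ∀ k ≤ i, c ((i - k : ℕ) : ℤ) + ((i - k : ℕ) : ℝ) * X ≤ c (i : ℤ) + i * X := by
    intro k
    induction k with
    | zero => intro; exact le_rfl
    | succ k ih =>
      intro hk
      have := ih (by omega)
      have h3 := h1 (i - (k + 1)) (by omega)
      unfold bb at h3
      obtain ⟨n, hn⟩ : ∃ n, i - (k + 1) = n := ⟨_, rfl⟩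
      have hn' : i - k = n + 1 := by omega
      rw [hn] at h3 ⊢
      rw [hn'] at this
      push_cast at this
      linarith
  apply le_antisymm
  · refine Finset.sup'_le _ _ fun j hj => ?_
    rw [Finset.mem_range] at hj
    rcases le_total i j with h | h
    · exact up j h (by omega)
    · have := dn (i - j) (by omega)
      have e : i - (i - j) = j := by omega
      rwa [e] at this
  · exact Finset.le_sup' (fun i : ℕ => c (i : ℤ) + (i : ℝ) * X) (Finset.mem_range.2 (by omega))

lemma Ptilde_ge {g : ℕ} {c : ℤ → ℝ} (X : ℝ) : c 0 ≤ Ptilde g c X := by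
  have := Finset.le_sup' (s := Finset.range (g + 2)) (fun i : ℕ => c (i : ℤ) + (i : ℝ) * X)
    (b := 0) (Finset.mem_range.2 (by omega))
  unfold Ptilde
  refine le_trans ?_ this
  simp

lemma Ptilde_cont (g : ℕ) (c : ℤ → ℝ) : Continuous (Ptilde g c) := by
  unfold Ptilde
  exact Continuous.finset_sup'_apply _ fun i _ => by fun_prop

lemma loc_ev (g : ℕ) (c : ℤ → ℝ) (X : ℝ) : ∀ᶠ t in 𝓝 (0 : ℝ), ∀ j ∈ Finset.range (g + 1),
    (bb c j < X → bb c j < X + t) ∧ (X < bb c j → X + t < bb c j) := by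
  rw [Filter.eventually_all_finset]
  intro j _
  have hc : Continuous fun t : ℝ => X + t := by fun_prop
  have ht := hc.tendsto 0
  rw [add_zero] at ht
  rcases lt_trichotomy (bb c j) X with h | h | h
  · filter_upwards [ht.eventually (lt_mem_nhds h)] with t ht
    exact ⟨fun _ => ht, fun h' => absurd h' h.not_gt⟩
  · exact Filter.Eventually.of_forall fun t => ⟨fun h' => absurd h' h.not_lt,
      fun h' => absurd h' h.not_gt⟩
  · filter_upwards [ht.eventually (gt_mem_nhds h)] with t ht
    exact ⟨fun h' => absurd h' h.not_gt, fun _ => ht⟩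

lemma Ptilde_bp {g : ℕ} {c : ℤ → ℝ} (hc : Hyp g c) {i : ℕ} (hi : i ≤ g) :
    ∀ᶠ t in 𝓝 (0 : ℝ), Ptilde g c (bb c i + t) = Ptilde g c (bb c i) + i * t + max t 0 := by
  have h0 : Ptilde g c (bb c i) = c (i : ℤ) + i * bb c i :=
    Ptilde_eq (by omega) (fun j hj => bb_le hc hj.le hi) (fun j hj hj2 => bb_le hc hj hj2)
  filter_upwards [loc_ev g c (bb c i)] with t ht
  have hlo : ∀ j < i, bb c j ≤ bb c i + t := fun j hj =>
    ((ht j (Finset.mem_range.2 (by omega))).1 (bb_lt hc hj hi)).le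
  have hup : ∀ j, i < j → j ≤ g → bb c i + t ≤ bb c j := fun j hj hj2 =>
    ((ht j (Finset.mem_range.2 (by omega))).2 (bb_lt hc hj hj2)).le
  rcases le_total t 0 with h | h
  · rw [h0, Ptilde_eq (i := i) (by omega) hlo, max_eq_right h]
    · ring
    · intro j hj hj2
      rcases hj.eq_or_lt with rfl | hj
      · linarith
      · exact hup j hj hj2
  · rw [h0, Ptilde_eq (i := i + 1) (by omega), max_eq_left h]
    · unfold bb
      push_cast
      ring
    · intro j hj
      rcases (Nat.lt_succ_iff.1 hj).eq_or_lt with rfl | hj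
      · linarith
      · exact hlo j hj
    · intro j hj hj2
      exact hup j hj hj2

lemma bb_g {g : ℕ} {c : ℤ → ℝ} (hc : Hyp g c) : bb c g = 0 := by
  unfold bb; rw [hc.1, hc.2.1]; ring

lemma Ptilde_nbp {g : ℕ} {c : ℤ → ℝ} (hc : Hyp g c) {X : ℝ} (hX : X ≤ 0) (hB : X ∉ BB g c) :
    ∃ i : ℕ, ∀ᶠ t in 𝓝 (0 : ℝ), Ptilde g c (X + t) = Ptilde g c X + i * t := by
  classical
  have hne : ∀ j ≤ g, X ≠ bb c j := fun j hj h => hB ⟨j, hj, h⟩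
  have hex : ∃ j, X < bb c j := ⟨g, by
    have := hne g le_rfl
    rw [bb_g hc] at *
    exact lt_of_le_of_ne hX this⟩
  obtain ⟨i, hi, hmin⟩ : ∃ i, X < bb c i ∧ ∀ j < i, ¬ X < bb c j :=
    ⟨Nat.find hex, Nat.find_spec hex, fun j hj => Nat.find_min hex hj⟩
  have hig : i ≤ g := by
    by_contra hh
    have := hmin g (by omega)
    have := hne g le_rfl
    rw [bb_g hc] at *
    exact ‹¬ X < 0› (lt_of_le_of_ne hX this)
  refine ⟨i, ?_⟩
  have hlo : ∀ j < i, bb c j < X := fun j hj =>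
    lt_of_le_of_ne (not_lt.1 (hmin j hj)) (hne j (by omega)).symm
  have hup : ∀ j, i ≤ j → j ≤ g → X < bb c j := fun j hj hj2 => hi.trans_le (bb_le hc hj hj2)
  have h0 := Ptilde_eq (g := g) (c := c) (X := X) (i := i) (by omega) (fun j hj => (hlo j hj).le)
    (fun j h1 h2 => (hup j h1 h2).le)
  filter_upwards [loc_ev g c X] with t ht
  rw [h0, Ptilde_eq (g := g) (c := c) (X := X + t) (i := i) (by omega)]
  · ring
  · exact fun j hj => ((ht j (Finset.mem_range.2 (by omega))).1 (hlo j hj)).le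
  · exact fun j h1 h2 => ((ht j (Finset.mem_range.2 (by omega))).2 (hup j h1 h2)).le

/-- The half-height of the curve. -/
noncomputable def RR (g : ℕ) (c : ℤ → ℝ) (X : ℝ) : ℝ := Ptilde g c X - c (-1) / 2

lemma to_side {p : ℝ → Prop} (h : ∀ᶠ t in 𝓝 (0 : ℝ), p t) (k : ℝ) :
    ∀ᶠ t in 𝓝[>] (0 : ℝ), p (k * t) := by
  have hc : Continuous fun t : ℝ => k * t := by fun_prop
  have ht := hc.tendsto 0
  rw [mul_zero] at ht
  exact (ht.mono_left nhdsWithin_le_nhds).eventually h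

lemma ldata {g : ℕ} {c : ℤ → ℝ} (hc : Hyp g c) : LData (c 0 - c 1) (RR g c) (BB g c) where
  pos X := by
    have := Ptilde_ge (g := g) (c := c) X
    have := hc.2.2.1
    unfold RR; linarith
  cont := (Ptilde_cont g c).sub continuous_const
  fin := by
    have : BB g c = (bb c) '' (Set.Iic g) := by
      ext x; simp only [BB, Set.mem_ofPred_eq, Set.mem_image, Set.mem_Iic]
      constructor
      · rintro ⟨i, hi, rfl⟩; exact ⟨i, hi, rfl⟩
      · rintro ⟨i, hi, rfl⟩; exact ⟨i, hi, rfl⟩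
    rw [this]
    exact (Set.finite_Iic g).image _
  side X h0 h1 τ hτ := by
    by_cases hB : X ∈ BB g c
    · obtain ⟨i, hi, rfl⟩ := hB
      have := to_side (Ptilde_bp hc hi) τ
      rcases hτ with rfl | rfl
      · refine ⟨i + 1, ?_⟩
        filter_upwards [this, pos_ev] with t ht ht0
        unfold RR
        rw [ht]; push_cast
        rw [max_eq_left (by linarith)]; ring
      · refine ⟨-i, ?_⟩
        filter_upwards [this, pos_ev] with t ht ht0
        unfold RR
        rw [ht]; push_cast
        rw [max_eq_right (by linarith)]; ring
    · obtain ⟨i, hi⟩ := Ptilde_nbp hc h1 hB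
      refine ⟨i * τ, ?_⟩
      filter_upwards [to_side hi τ] with t ht
      unfold RR
      rw [ht]; push_cast; ring

lemma Ftilde_eq (g : ℕ) (c : ℤ → ℝ) (P : ℝ × ℝ) :
    Ftilde g c P = P.2 + c (-1) / 2 + max |P.2 - c (-1) / 2| (RR g c P.1) := by
  unfold Ftilde RR
  rw [abs_eq_max_neg, ← max_add_add_left, ← max_add_add_left, max_assoc]
  congr 1
  · ring
  · conv_lhs => rw [max_comm]
    congr 1 <;> ring

lemma not_diff_max (k l : ℝ) (f : ℝ → ℝ) (hf : ∀ᶠ t in 𝓝 (0 : ℝ), f t = k + l * t + max t 0) :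
    ¬ DifferentiableAt ℝ f 0 := by
  intro h
  have h1 : DifferentiableAt ℝ (fun t => 2 * (f t - k - l * t) - t) 0 := by fun_prop
  refine not_differentiableAt_abs_zero (h1.congr_of_eventuallyEq ?_)
  filter_upwards [hf] with t ht
  rw [ht]
  rcases le_total t 0 with h | h
  · rw [max_eq_right h, abs_of_nonpos h]; ring
  · rw [max_eq_left h, abs_of_nonneg h]; ring

theorem Gam_eq {g : ℕ} {c : ℤ → ℝ} (hc : Hyp g c) :
    Gam g c = Gm (c (-1) / 2) (c 0 - c 1) (RR g c) (BB g c) := by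
  have hL := ldata hc
  have hFe : Ftilde g c = fun P => P.2 + c (-1) / 2 + max |P.2 - c (-1) / 2| (RR g c P.1) :=
    funext (Ftilde_eq g c)
  have hRc := hL.cont
  ext ⟨X, Y⟩
  simp only [Gam, curveBar, Gm, Set.mem_ofPred_eq, hFe]
  generalize c (-1) / 2 = m
  have hR := hL.pos X
  constructor
  · rintro ⟨hd, h0, h1⟩
    refine ⟨h0, h1, ?_⟩
    by_contra hcon
    push Not at hcon
    obtain ⟨hne, hcon⟩ := hcon
    apply hd
    rcases lt_or_gt_of_ne hne with hlt | hlt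
    · have hB : X ∉ BB g c := fun hB => (hcon hB).not_gt hlt
      obtain ⟨i, hi⟩ := Ptilde_nbp hc h1 hB
      have h2 : ∀ᶠ P : ℝ × ℝ in 𝓝 (X, Y), |P.2 - m| < RR g c P.1 :=
        (isOpen_lt (by fun_prop) (by fun_prop)).mem_nhds hlt
      have h3 : ∀ᶠ P : ℝ × ℝ in 𝓝 (X, Y), RR g c P.1 = RR g c X + i * (P.1 - X) := by
        have hcn : Continuous fun P : ℝ × ℝ => P.1 - X := by fun_prop
        have ht := hcn.tendsto (X, Y)
        simp only [sub_self] at ht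
        filter_upwards [ht.eventually hi] with P hP
        unfold RR
        rw [add_sub_cancel] at hP
        rw [hP]; ring
      have h4 : DifferentiableAt ℝ (fun P : ℝ × ℝ => P.2 + m + (RR g c X + i * (P.1 - X))) (X, Y) := by
        fun_prop
      refine h4.congr_of_eventuallyEq ?_
      filter_upwards [h2, h3] with P h2 h3
      rw [max_eq_right h2.le, h3]
    · have h2 : ∀ᶠ P : ℝ × ℝ in 𝓝 (X, Y), RR g c P.1 < |P.2 - m| :=
        (isOpen_lt (by fun_prop) (by fun_prop)).mem_nhds hlt
      have hY : Y - m ≠ 0 := abs_pos.1 (hR.trans hlt)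
      have h3 : DifferentiableAt ℝ (fun P : ℝ × ℝ => P.2 - m) (X, Y) := by fun_prop
      have h4 : DifferentiableAt ℝ (fun P : ℝ × ℝ => P.2 + m + |P.2 - m|) (X, Y) :=
        DifferentiableAt.add (by fun_prop) (h3.abs hY)
      refine h4.congr_of_eventuallyEq ?_
      filter_upwards [h2] with P h2
      rw [max_eq_left h2.le]
  · rintro ⟨h0, h1, h2⟩
    refine ⟨fun hd => ?_, h0, h1⟩
    have hcases : |Y - m| = RR g c X ∨ (X ∈ BB g c ∧ |Y - m| < RR g c X) := by
      rcases h2 with h | ⟨h, h'⟩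
      · exact Or.inl h
      · rcases h'.eq_or_lt with h' | h'
        · exact Or.inl h'
        · exact Or.inr ⟨h, h'⟩
    rcases hcases with h | ⟨hB, h⟩
    · obtain ⟨σ, hσ, hy⟩ : ∃ σ : ℝ, |σ| = 1 ∧ Y - m = σ * RR g c X := by
        rcases abs_choice (Y - m) with h3 | h3
        · exact ⟨1, by simp, by linarith⟩
        · exact ⟨-1, by simp, by linarith⟩
      have hl : DifferentiableAt ℝ (fun t : ℝ => ((X, Y + σ * t) : ℝ × ℝ)) 0 := by fun_prop
      have hd' : DifferentiableAt ℝ (fun P : ℝ × ℝ => P.2 + m + max |P.2 - m| (RR g c P.1))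
          ((fun t : ℝ => ((X, Y + σ * t) : ℝ × ℝ)) 0) := by simpa using hd
      have := hd'.comp (0 : ℝ) hl
      refine not_diff_max (Y + m + RR g c X) σ _ ?_ this
      have hpos : ∀ᶠ t in 𝓝 (0 : ℝ), -RR g c X < t := lt_mem_nhds (by linarith)
      filter_upwards [hpos] with t ht
      simp only [Function.comp]
      have e : Y + σ * t - m = σ * (RR g c X + t) := by linear_combination hy
      rw [e, abs_mul, hσ, one_mul, abs_of_pos (by linarith)]
      have e2 : max (RR g c X + t) (RR g c X) = RR g c X + max t 0 := by
        rw [← max_add_add_left, add_zero]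
      rw [e2]; ring
    · obtain ⟨i, hi, rfl⟩ := hB
      have hl : DifferentiableAt ℝ (fun t : ℝ => ((bb c i + t, Y) : ℝ × ℝ)) 0 := by fun_prop
      have hd' : DifferentiableAt ℝ (fun P : ℝ × ℝ => P.2 + m + max |P.2 - m| (RR g c P.1))
          ((fun t : ℝ => ((bb c i + t, Y) : ℝ × ℝ)) 0) := by simpa using hd
      have := hd'.comp (0 : ℝ) hl
      refine not_diff_max (Y + m + RR g c (bb c i)) i _ ?_ this
      have hpos : ∀ᶠ t in 𝓝 (0 : ℝ), |Y - m| < RR g c (bb c i + t) := by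
        refine (isOpen_lt (by fun_prop) (by fun_prop)).mem_nhds ?_
        simpa using h
      filter_upwards [hpos, Ptilde_bp hc hi] with t ht ht2
      simp only [Function.comp]
      rw [max_eq_right ht.le]
      unfold RR
      rw [ht2]; ring

lemma conj_conj (c : ℤ → ℝ) (P : ℝ × ℝ) : conj c (conj c P) = P := by
  simp [conj]

lemma conj_mem {g : ℕ} {c : ℤ → ℝ} (hc : Hyp g c) {P : ℝ × ℝ} (h : P ∈ Gam g c) :
    conj c P ∈ Gam g c := by
  rw [Gam_eq hc] at *
  obtain ⟨h0, h1, h2⟩ := h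
  refine ⟨h0, h1, ?_⟩
  have : |(conj c P).2 - c (-1) / 2| = |P.2 - c (-1) / 2| := by
    rw [← abs_neg]; congr 1; simp only [conj]; ring
  rw [this]
  exact h2

lemma conj_alphaOpen {g : ℕ} {c : ℤ → ℝ} (hc : Hyp g c) {P : ℝ × ℝ} {k : ℕ}
    (h : conj c P ∈ alphaOpen g c k) : P ∈ alphaOpen g c k := by
  obtain ⟨h1, h2, h3, h4⟩ := h
  refine ⟨by simpa [conj_conj] using conj_mem hc h1, h2, ?_, ?_⟩
  · rintro rfl; exact h4 rfl
  · rintro rfl; exact h3 (conj_conj _ _)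

theorem main_aux (g : ℕ) (c : ℤ → ℝ) (hg : Even g)
    (hc : Hyp g c) (Pt : Fin g → ℝ × ℝ)
    (hPt : (∑ i : Fin g, Finsupp.single (Pt i) (1 : ℤ)) ∈ Dtilde g c) :
    ((∑ i : Fin g, Finsupp.single (conj c (Pt i)) (1 : ℤ)) ∈ Dtilde g c)
    ∧ IsPrincipal (Gam g c)
        (((∑ i : Fin g, Finsupp.single (Pt i) (1 : ℤ)) - DstarEven g c)
          + ((∑ i : Fin g, Finsupp.single (conj c (Pt i)) (1 : ℤ)) - DstarEven g c)) := by
  obtain ⟨Qt, hQ1, hQ2, hQ3⟩ := hPt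
  have hmap : ∀ At : Fin g → ℝ × ℝ, (∑ i : Fin g, Finsupp.single (conj c (At i)) (1 : ℤ)) =
      Finsupp.mapDomain (conj c) (∑ i : Fin g, Finsupp.single (At i) (1 : ℤ)) := by
    intro At
    rw [Finsupp.mapDomain_finsetSum]
    simp only [Finsupp.mapDomain_single]
  rw [hmap, hQ3, ← hmap]
  constructor
  · refine ⟨fun i => conj c (Qt i), fun i => ?_, fun k h1 h2 i j hi hj => ?_, rfl⟩
    · obtain ⟨ha, hb⟩ := hQ1 i
      exact ⟨conj_mem hc ha, hb⟩
    · exact hQ2 k h1 h2 i j (conj_alphaOpen hc hi) (conj_alphaOpen hc hj)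
  · have hL := ldata hc
    have key : (((∑ i : Fin g, Finsupp.single (Qt i) (1 : ℤ)) - DstarEven g c)
          + ((∑ i : Fin g, Finsupp.single (conj c (Qt i)) (1 : ℤ)) - DstarEven g c)) =
        ∑ i : Fin g, (Finsupp.single (Qt i) (1 : ℤ) + Finsupp.single (conj c (Qt i)) 1 -
          (Finsupp.single (V g c 0) 1 + Finsupp.single (conj c (V g c 0)) 1)) := by
      rw [Finset.sum_sub_distrib, Finset.sum_add_distrib, Finset.sum_const, Finset.card_univ,
        Fintype.card_fin]
      unfold DstarEven
      generalize (Finsupp.single (V g c 0) (1 : ℤ) + Finsupp.single (conj c (V g c 0)) 1) = W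
      obtain ⟨n, rfl⟩ := hg
      have e : (n + n) / 2 = n := by omega
      rw [e, natCast_zsmul, add_smul]
      abel
    rw [key, Gam_eq hc]
    refine IsPrincipal.sum (fun P => hL.dirs_finite P) (fun P hP => hL.hcl P hP) _ _ fun i _ => ?_
    have hP0 : Ptilde g c 0 = 0 := by
      have := Ptilde_eq (g := g) (c := c) (X := 0) (i := g) (by omega)
        (fun j hj => by rw [← bb_g hc]; exact bb_le hc hj.le le_rfl)
        (fun j hj hj2 => by
          have : j = g := by omega
          rw [this, bb_g hc])
      rw [this, hc.2.1]; simp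
    have hV : V g c 0 = (0, 0) := by
      simp [V, hc.1, hc.2.1]
    refine principal_pair hL ?_ ?_ ?_ ?_
    · rw [← Gam_eq hc]; exact (hQ1 i).1
    · simp only [conj]; congr 1; ring
    · rw [hV]; simp [RR, hP0]
    · rw [hV]; simp only [RR, hP0, conj]; congr 1; ring

end TropicalHyperelliptic

end Helpers

/-- Let `g` be even, `Γ̄` the tropical hyperelliptic curve of genus `g`, `Γ` its
bounded part, and `D* = (g/2)(V_0 + V_0′)`.  For any
`𝑷 = (P_1, …, P_g) ∈ Γ_g^+` (i.e. with `P_1 + ⋯ + P_g ∈ 𝔇̃_g^+(Γ)`), the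
conjugate tuple `𝑷′ = (P_1′, …, P_g′)` also lies in `Γ_g^+`, and
`𝑷 + 𝑷′ = 𝒪` in the group `(Γ_g^+, 𝒪)`: the sum
`φ̄(P_1 + ⋯ + P_g) + φ̄(P_1′ + ⋯ + P_g′) = 0` in `J(Γ)`, i.e.
`(ΣP_i − D*) + (ΣP_i′ − D*)` is a principal divisor.  Hence `−𝑷 = 𝑷′`. -/
theorem add_conj_eq_unit_even (g : ℕ) (c : ℤ → ℝ) (hg : Even g) (hg2 : 2 ≤ g)
    (hc : Hyp g c) (Pt : Fin g → ℝ × ℝ)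
    (hPt : (∑ i : Fin g, Finsupp.single (Pt i) (1 : ℤ)) ∈ Dtilde g c) :
    ((∑ i : Fin g, Finsupp.single (conj c (Pt i)) (1 : ℤ)) ∈ Dtilde g c)
    ∧ IsPrincipal (Gam g c)
        (((∑ i : Fin g, Finsupp.single (Pt i) (1 : ℤ)) - DstarEven g c)
          + ((∑ i : Fin g, Finsupp.single (conj c (Pt i)) (1 : ℤ)) - DstarEven g c)) := by
  exact main_aux g c hg hc Pt hPt
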